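/- arXiv:1708.07419 — 4 statements merged into one kernel-verified Lean document; each statement's English description precedes it below -/
import Mathlib

section
/- Let L be a Lie algebra over a commutative ring K and let a, b, c ∈ L. For every natural number n there exists v ∈ L such that ⁅(ad a)^{2n} b, c⁆ + ⁅(ad a)^{2n} c, b⁆ + ⁅v, a⁆ = 0. -/
/-- Bracketing on the right by `a` is a derivation. -/
theorem lie_lie_right_eq_sub {L : Type*} [LieRing L] (a b c : L) :
    ⁅⁅b, a⁆, c⁆ = ⁅⁅b, c⁆, a⁆ - ⁅b, ⁅c, a⁆⁆ := by
  rw [lie_lie b a c, ← lie_skew ⁅b, c⁆ a, ← lie_skew c a, lie_neg]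
  abel

/-- Modulo `⁅L, a⁆`, iterates of `x ↦ ⁅x, a⁆` move across the bracket up to sign. -/
theorem exists_iterate_lie_eq_smul_add {L : Type*} [LieRing L] (a b c : L) (k : ℕ) :
    ∃ v : L, ⁅(fun x : L => ⁅x, a⁆)^[k] b, c⁆ =
      (-1 : ℤ) ^ k • ⁅b, (fun x : L => ⁅x, a⁆)^[k] c⁆ + ⁅v, a⁆ := by
  induction k generalizing b with
  | zero => exact ⟨0, by simp⟩
  | succ k ih =>
    obtain ⟨v, hv⟩ := ih ⁅b, a⁆
    refine ⟨v + (-1 : ℤ) ^ k • ⁅b, (fun x : L => ⁅x, a⁆)^[k] c⁆, ?_⟩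
    rw [Function.iterate_succ_apply, Function.iterate_succ_apply', hv, lie_lie_right_eq_sub,
      add_lie, smul_lie, pow_succ, smul_sub, mul_neg_one, neg_smul]
    abel

theorem even_ad_anticomm {K L : Type*} [CommRing K] [LieRing L] [LieAlgebra K L]
    (a b c : L) (n : ℕ) :
    ∃ v : L,
      ⁅(fun x : L => ⁅x, a⁆)^[2 * n] b, c⁆ + ⁅(fun x : L => ⁅x, a⁆)^[2 * n] c, b⁆ + ⁅v, a⁆ = 0 := by
  obtain ⟨v, hv⟩ := exists_iterate_lie_eq_smul_add a b c (2 * n)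
  refine ⟨-v, ?_⟩
  rw [hv, (even_two_mul n).neg_one_pow, one_smul, neg_lie, ← lie_skew b]
  abel
end

section
/- Let L be the free Lie algebra over a field K on a set X containing an element a. Then the centralizer of ι(a) in L is the one-dimensional subspace K·ι(a); that is, for u ∈ L, ⁅u, ι(a)⁆ = 0 if and only if u = α • ι(a) for some α ∈ K. -/
namespace LieAlgebra.PBW

variable {R L ι : Type*} [CommRing R] [LieRing L] [LieAlgebra R L]

/-- The submodule of `Multiset ι →₀ R` spanned by the multisets of cardinality at most `n`. -/
noncomputable def degreeLE (R : Type*) {ι : Type*} [CommRing R] (n : ℕ) :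
    Submodule R (Multiset ι →₀ R) :=
  Finsupp.supported R R {M | M.card ≤ n}

lemma single_mem_degreeLE {n : ℕ} {M : Multiset ι} (h : M.card ≤ n) :
    Finsupp.single M (1 : R) ∈ degreeLE R n :=
  Finsupp.single_mem_supported R 1 h

lemma degreeLE_mono {m n : ℕ} (h : m ≤ n) :
    (degreeLE R m : Submodule R (Multiset ι →₀ R)) ≤ degreeLE R n :=
  Finsupp.supported_mono fun _ hM => le_trans hM h

lemma apply_mem_of_forall_basis (b : Module.Basis ι R L) {n : ℕ}
    {T : Submodule R (Multiset ι →₀ R)}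
    (f : L →ₗ[R] (Multiset ι →₀ R) →ₗ[R] (Multiset ι →₀ R))
    (h : ∀ i (M : Multiset ι), M.card ≤ n → f (b i) (Finsupp.single M 1) ∈ T)
    (x : L) {s : Multiset ι →₀ R} (hs : s ∈ degreeLE R n) : f x s ∈ T := by
  rw [degreeLE, Finsupp.supported_eq_span_single] at hs
  induction hs using Submodule.span_induction with
  | mem s hs =>
    obtain ⟨M, hM, rfl⟩ := hs
    induction b.mem_span x using Submodule.span_induction with
    | mem x hx => obtain ⟨i, rfl⟩ := hx; exact h i M hM
    | zero => simp
    | add x y _ _ hx hy => simpa using T.add_mem hx hy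
    | smul c x _ hx => simpa using T.smul_mem c hx
  | zero => simp
  | add s t _ _ hs ht => simpa using T.add_mem hs ht
  | smul c s _ hs => simpa using T.smul_mem c hs

/-- The bilinear map `L → S → S` with prescribed values on basis vectors and multisets. -/
noncomputable def extend (b : Module.Basis ι R L) (g : ι → Multiset ι → Multiset ι →₀ R) :
    L →ₗ[R] (Multiset ι →₀ R) →ₗ[R] (Multiset ι →₀ R) :=
  b.constr R fun i => Finsupp.linearCombination R (g i)

@[simp]
lemma extend_basis_single (b : Module.Basis ι R L) (g : ι → Multiset ι → Multiset ι →₀ R)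
    (i : ι) (M : Multiset ι) : extend b g (b i) (Finsupp.single M 1) = g i M := by
  simp [extend]

lemma extend_congr (b : Module.Basis ι R L) {g g' : ι → Multiset ι → Multiset ι →₀ R} {n : ℕ}
    (h : ∀ i (M : Multiset ι), M.card ≤ n → g i M = g' i M) (x : L) {s : Multiset ι →₀ R}
    (hs : s ∈ degreeLE R n) : extend b g x s = extend b g' x s := by
  rw [degreeLE, Finsupp.supported_eq_span_single] at hs
  induction hs using Submodule.span_induction with
  | mem s hs =>
    obtain ⟨M, hM, rfl⟩ := hs
    induction b.mem_span x using Submodule.span_induction with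
    | mem x hx => obtain ⟨i, rfl⟩ := hx; simpa using h i M hM
    | zero => simp
    | add x y _ _ hx hy => simp [hx, hy]
    | smul c x _ hx => simp [hx]
  | zero => simp
  | add s t _ _ hs ht => simp [hs, ht]
  | smul c s _ hs => simp [hs]

lemma extend_mem_degreeLE_succ (b : Module.Basis ι R L) {g : ι → Multiset ι → Multiset ι →₀ R}
    {n m : ℕ} (h : ∀ i (M : Multiset ι), M.card ≤ n →
      g i M - Finsupp.single (i ::ₘ M) 1 ∈ degreeLE R M.card) (hmn : m ≤ n) (x : L)
    {s : Multiset ι →₀ R} (hs : s ∈ degreeLE R m) : extend b g x s ∈ degreeLE R (m + 1) := by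
  refine apply_mem_of_forall_basis b _ (fun i M hM => ?_) x hs
  rw [extend_basis_single, ← sub_add_cancel (g i M) (Finsupp.single (i ::ₘ M) 1)]
  exact add_mem (degreeLE_mono (by lia) (h i M (hM.trans hmn)))
    (single_mem_degreeLE (by simpa using hM))

variable [LinearOrder ι]

lemma forall_le_or_exists_cons (i : ι) (M : Multiset ι) :
    (∀ k ∈ M, i ≤ k) ∨ ∃ j N, M = j ::ₘ N ∧ (∀ k ∈ N, j ≤ k) ∧ j < i := by
  classical
  by_cases h : ∀ k ∈ M, i ≤ k
  · exact .inl h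
  right
  push Not at h
  obtain ⟨k, hk, hki⟩ := h
  obtain ⟨j, hj, hmin⟩ := M.toFinset.exists_min_image id ⟨k, by simpa using hk⟩
  simp only [Multiset.mem_toFinset, id] at hj hmin
  exact ⟨j, M.erase j, (Multiset.cons_erase hj).symm,
    fun l hl => hmin l (Multiset.mem_of_mem_erase hl), (hmin k hk).trans_lt hki⟩

lemma eq_and_eq_of_cons_eq_cons {i j : ι} {M N : Multiset ι} (hM : ∀ k ∈ M, i ≤ k)
    (hN : ∀ k ∈ N, j ≤ k) (h : i ::ₘ M = j ::ₘ N) : i = j ∧ M = N := by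
  have hij : i = j := by
    apply le_antisymm
    · rcases Multiset.mem_cons.1 (h ▸ Multiset.mem_cons_self j N) with h' | h'
      exacts [h'.ge, hM _ h']
    · rcases Multiset.mem_cons.1 (h ▸ Multiset.mem_cons_self i M) with h' | h'
      exacts [h'.ge, hN _ h']
  subst hij
  exact ⟨rfl, (Multiset.cons_inj_right i).1 h⟩

open Classical in
/-- The value of the basis vector `i` acting on the multiset `M`, correct for `M.card ≤ n`. -/
noncomputable def stage (b : Module.Basis ι R L) : ℕ → ι → Multiset ι → Multiset ι →₀ R
  | 0, i, M => Finsupp.single (i ::ₘ M) 1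
  | n + 1, i, M =>
    if h : ∃ p : ι × Multiset ι, M = p.1 ::ₘ p.2 ∧ (∀ k ∈ p.2, p.1 ≤ k) ∧ p.1 < i then
      Finsupp.single (i ::ₘ M) 1
        + extend b (stage b n) (b h.choose.1)
            (extend b (stage b n) (b i) (Finsupp.single h.choose.2 1)
              - Finsupp.single (i ::ₘ h.choose.2) 1)
        + extend b (stage b n) ⁅b i, b h.choose.1⁆ (Finsupp.single h.choose.2 1)
    else Finsupp.single (i ::ₘ M) 1

lemma stage_of_le (b : Module.Basis ι R L) (n : ℕ) {i : ι} {M : Multiset ι}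
    (h : ∀ k ∈ M, i ≤ k) : stage b n i M = Finsupp.single (i ::ₘ M) 1 := by
  cases n with
  | zero => rfl
  | succ n =>
    rw [stage, dif_neg]
    rintro ⟨p, rfl, -, hp⟩
    exact (h p.1 (Multiset.mem_cons_self _ _)).not_gt hp

lemma stage_succ (b : Module.Basis ι R L) (n : ℕ) {i j : ι} {N : Multiset ι}
    (hN : ∀ k ∈ N, j ≤ k) (hji : j < i) :
    stage b (n + 1) i (j ::ₘ N) = Finsupp.single (i ::ₘ j ::ₘ N) 1
        + extend b (stage b n) (b j)
            (stage b n i N - Finsupp.single (i ::ₘ N) 1)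
        + extend b (stage b n) ⁅b i, b j⁆ (Finsupp.single N 1) := by
  have h : ∃ p : ι × Multiset ι, j ::ₘ N = p.1 ::ₘ p.2 ∧ (∀ k ∈ p.2, p.1 ≤ k) ∧ p.1 < i :=
    ⟨(j, N), rfl, hN, hji⟩
  obtain ⟨hcons, hle, -⟩ := h.choose_spec
  obtain ⟨hj, hp⟩ := eq_and_eq_of_cons_eq_cons hle hN hcons.symm
  rw [stage, dif_pos h, hj, hp, extend_basis_single]

lemma stage_sub_mem (b : Module.Basis ι R L) (n : ℕ) (i : ι) (M : Multiset ι)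
    (hM : M.card ≤ n) : stage b n i M - Finsupp.single (i ::ₘ M) 1 ∈ degreeLE R M.card := by
  induction n generalizing i M with
  | zero => simp [stage]
  | succ n ih =>
    rcases forall_le_or_exists_cons i M with h | ⟨j, N, rfl, hN, hji⟩
    · simp [stage_of_le b _ h]
    · rw [Multiset.card_cons] at hM ⊢
      rw [stage_succ b n hN hji, add_assoc, add_sub_cancel_left]
      exact add_mem (extend_mem_degreeLE_succ b ih (by lia) _ (ih i N (by lia)))
        (extend_mem_degreeLE_succ b ih (by lia) _ (single_mem_degreeLE le_rfl))

lemma stage_succ_eq (b : Module.Basis ι R L) (n : ℕ) (i : ι) (M : Multiset ι)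
    (hM : M.card ≤ n) : stage b (n + 1) i M = stage b n i M := by
  induction n generalizing i M with
  | zero =>
    obtain rfl : M = 0 := Multiset.card_eq_zero.1 (by lia)
    rw [stage_of_le _ _ (by simp), stage_of_le _ _ (by simp)]
  | succ n ih =>
    rcases forall_le_or_exists_cons i M with h | ⟨j, N, rfl, hN, hji⟩
    · simp [stage_of_le b _ h]
    · rw [Multiset.card_cons] at hM
      rw [stage_succ b n hN hji, stage_succ b (n + 1) hN hji, ih i N (by lia),
        extend_congr b ih _ (degreeLE_mono (by lia) (stage_sub_mem b n i N (by lia))),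
        extend_congr b ih _ (single_mem_degreeLE (by lia))]

lemma stage_eq_stage_card (b : Module.Basis ι R L) {n : ℕ} (i : ι) (M : Multiset ι)
    (hM : M.card ≤ n) : stage b n i M = stage b M.card i M := by
  induction n, hM using Nat.le_induction with
  | base => rfl
  | succ n hn ih => rw [stage_succ_eq b n i M hn, ih]

/-- The action of `L` on the free module on multisets of basis indices. -/
noncomputable def action (b : Module.Basis ι R L) :
    L →ₗ[R] (Multiset ι →₀ R) →ₗ[R] (Multiset ι →₀ R) :=
  extend b fun i M => stage b M.card i M

lemma action_of_le (b : Module.Basis ι R L) {i : ι} {M : Multiset ι} (h : ∀ k ∈ M, i ≤ k) :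
    action b (b i) (Finsupp.single M 1) = Finsupp.single (i ::ₘ M) 1 := by
  rw [action, extend_basis_single, stage_of_le b _ h]

lemma action_sub_mem (b : Module.Basis ι R L) (i : ι) (M : Multiset ι) :
    action b (b i) (Finsupp.single M 1) - Finsupp.single (i ::ₘ M) 1 ∈ degreeLE R M.card := by
  rw [action, extend_basis_single]
  exact stage_sub_mem b _ i M le_rfl

lemma extend_stage (b : Module.Basis ι R L) {n : ℕ} (x : L) {s : Multiset ι →₀ R}
    (hs : s ∈ degreeLE R n) : extend b (stage b n) x s = action b x s :=
  extend_congr b (fun i M hM => stage_eq_stage_card b i M hM) x hs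

lemma action_action_of_lt (b : Module.Basis ι R L) {i j : ι} {N : Multiset ι}
    (hN : ∀ k ∈ N, j ≤ k) (hji : j < i) :
    action b (b i) (action b (b j) (Finsupp.single N 1)) =
      action b (b j) (action b (b i) (Finsupp.single N 1))
        + action b ⁅b i, b j⁆ (Finsupp.single N 1) := by
  have hiN : ∀ k ∈ i ::ₘ N, j ≤ k := by
    intro k hk
    rcases Multiset.mem_cons.1 hk with rfl | hk
    exacts [hji.le, hN k hk]
  have h : stage b N.card i N = action b (b i) (Finsupp.single N 1) := by
    rw [action, extend_basis_single]
  rw [action_of_le b hN]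
  conv_lhs => rw [action, extend_basis_single, Multiset.card_cons, stage_succ b _ hN hji, h,
    extend_stage b _ (action_sub_mem b i N), extend_stage b _ (single_mem_degreeLE le_rfl),
    map_sub, action_of_le b hiN, Multiset.cons_swap, add_sub_cancel]

lemma action_action_of_forall_basis (b : Module.Basis ι R L) {n : ℕ}
    (h : ∀ i j (N : Multiset ι), N.card ≤ n →
      action b (b i) (action b (b j) (Finsupp.single N 1)) =
        action b (b j) (action b (b i) (Finsupp.single N 1))
          + action b ⁅b i, b j⁆ (Finsupp.single N 1))
    (x y : L) {s : Multiset ι →₀ R} (hs : s ∈ degreeLE R n) :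
    action b x (action b y s) = action b y (action b x s) + action b ⁅x, y⁆ s := by
  rw [degreeLE, Finsupp.supported_eq_span_single] at hs
  induction hs using Submodule.span_induction with
  | mem s hs =>
    obtain ⟨N, hN, rfl⟩ := hs
    induction b.mem_span x using Submodule.span_induction with
    | mem x hx =>
      obtain ⟨i, rfl⟩ := hx
      induction b.mem_span y using Submodule.span_induction with
      | mem y hy => obtain ⟨j, rfl⟩ := hy; exact h i j N hN
      | zero => simp
      | add y z _ _ hy hz => simp only [map_add, LinearMap.add_apply, lie_add, hy, hz]; abel
      | smul c y _ hy => simp [hy]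
    | zero => simp
    | add x z _ _ hx hz => simp only [map_add, LinearMap.add_apply, add_lie, hx, hz]; abel
    | smul c x _ hx => simp [hx]
  | zero => simp
  | add s t _ _ hs ht => simp only [map_add, hs, ht]; abel
  | smul c s _ hs => simp [hs]

lemma action_action_of_mem_degreeLE (b : Module.Basis ι R L) (n : ℕ) (x y : L)
    {s : Multiset ι →₀ R} (hs : s ∈ degreeLE R n) :
    action b x (action b y s) = action b y (action b x s) + action b ⁅x, y⁆ s := by
  induction n using Nat.strong_induction_on generalizing x y s with
  | _ n ih =>
  refine action_action_of_forall_basis b (fun i j N hN => ?_) x y hs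
  wlog hji : j < i generalizing i j
  · rcases (not_lt.1 hji).eq_or_lt with rfl | hij
    · simp
    · rw [this j i hij, ← lie_skew (b i) (b j), map_neg, LinearMap.neg_apply]
      abel
  rcases forall_le_or_exists_cons j N with h | ⟨k, Q, rfl, hQ, hkj⟩
  · exact action_action_of_lt b h hji
  rw [Multiset.card_cons] at hN
  have ihQ (x y : L) := ih Q.card (by lia) x y (single_mem_degreeLE le_rfl)
  have key {i j : ι} (hki : k < i) (hkj : k < j) :
      action b (b i) (action b (b k) (action b (b j) (Finsupp.single Q 1))) =
        action b (b k) (action b (b i) (action b (b j) (Finsupp.single Q 1)))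
          + action b ⁅b i, b k⁆ (action b (b j) (Finsupp.single Q 1)) := by
    have hjQ : ∀ l ∈ j ::ₘ Q, k ≤ l := by
      intro l hl
      rcases Multiset.mem_cons.1 hl with rfl | hl
      exacts [hkj.le, hQ l hl]
    rw [← sub_add_cancel (action b (b j) (Finsupp.single Q 1)) (Finsupp.single (j ::ₘ Q) 1)]
    simp only [map_add]
    rw [ih Q.card (by lia) (b i) (b k) (action_sub_mem b j Q), action_action_of_lt b hjQ hki]
    abel
  rw [← action_of_le b hQ, ihQ (b j) (b k), ihQ (b i) (b k), ihQ ⁅b i, b j⁆ (b k)]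
  simp only [map_add]
  rw [key (hkj.trans hji) hkj, key hkj (hkj.trans hji), ihQ (b i) (b j), ihQ (b i) ⁅b j, b k⁆,
    ihQ (b j) ⁅b i, b k⁆, lie_lie (b i) (b j) (b k)]
  simp only [map_add, map_sub, LinearMap.sub_apply]
  abel

lemma action_action (b : Module.Basis ι R L) (x y : L) (s : Multiset ι →₀ R) :
    action b x (action b y s) = action b y (action b x s) + action b ⁅x, y⁆ s :=
  action_action_of_mem_degreeLE b (s.support.sup Multiset.card) x y <|
    (Finsupp.mem_supported R s).2 fun _ hM => Finset.le_sup (f := Multiset.card) hM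

attribute [local instance] LieRing.ofAssociativeRing

/-- The representation of `L` on the free module on multisets of basis indices. -/
noncomputable def representation (b : Module.Basis ι R L) :
    L →ₗ⁅R⁆ Module.End R (Multiset ι →₀ R) :=
  { action b with
    map_lie' := by
      intro x y
      refine LinearMap.ext fun s => ?_
      exact (sub_eq_of_eq_add' (action_action b x y s)).symm }

lemma representation_injective (b : Module.Basis ι R L) :
    Function.Injective (representation b) := by
  have h : Function.Injective (Finsupp.mapDomain (M := R) fun i : ι => i ::ₘ (0 : Multiset ι)) :=
    Finsupp.mapDomain_injective fun i j hij => by simpa using hij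
  have hrep (x : L) : representation b x (Finsupp.single 0 1) =
      Finsupp.mapDomain (fun i : ι => i ::ₘ (0 : Multiset ι)) (b.repr x) := by
    change action b x (Finsupp.single 0 1) = _
    induction b.mem_span x using Submodule.span_induction with
    | mem x hx => obtain ⟨i, rfl⟩ := hx; simp [action_of_le, Finsupp.mapDomain_single]
    | zero => simp
    | add x y _ _ hx hy => simp [hx, hy, Finsupp.mapDomain_add]
    | smul c x _ hx => simp [hx, Finsupp.mapDomain_smul]
  intro x y hxy
  exact b.repr.injective (h (by rw [← hrep, ← hrep, hxy]))

end LieAlgebra.PBW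

section FreeLieAlgebra

attribute [local instance] LieRing.ofAssociativeRing

/-- The canonical map from a free Lie algebra over a field to the monoid algebra of words is
injective. -/
theorem FreeLieAlgebra.lift_monoidAlgebra_injective (K X : Type*) [Field K] :
    Function.Injective (FreeLieAlgebra.lift K fun x : X =>
      MonoidAlgebra.of K (FreeMonoid X) (FreeMonoid.of x)) := by
  let b := Module.Basis.ofVectorSpace K (FreeLieAlgebra K X)
  classical
  let : LinearOrder (Module.Basis.ofVectorSpaceIndex K (FreeLieAlgebra K X)) :=
    linearOrderOfSTO WellOrderingRel
  let ρ := LieAlgebra.PBW.representation b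
  let F : MonoidAlgebra K (FreeMonoid X) →ₐ[K] Module.End K (Multiset _ →₀ K) :=
    MonoidAlgebra.lift K (Module.End K _) (FreeMonoid X)
      (FreeMonoid.lift fun x => ρ (FreeLieAlgebra.of K x))
  let G := AlgHom.toLieHom (A := MonoidAlgebra K (FreeMonoid X))
    (B := Module.End K (Multiset _ →₀ K)) F
  have h : G.comp (FreeLieAlgebra.lift K fun x : X =>
      MonoidAlgebra.of K (FreeMonoid X) (FreeMonoid.of x)) = ρ := by
    ext1 x
    simp [G, F]
  refine Function.Injective.of_comp (f := G) ?_
  rw [← LieHom.coe_comp, h]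
  exact LieAlgebra.PBW.representation_injective b

/-- An element of the monoid algebra of words that commutes with the letter `a` is supported on
powers of `a`. -/
lemma coeff_eq_zero_of_commute_of {K X : Type*} [CommRing K] {a : X}
    {f : MonoidAlgebra K (FreeMonoid X)}
    (h : Commute f (MonoidAlgebra.of K (FreeMonoid X) (FreeMonoid.of a)))
    {c : X} (hc : c ≠ a) (n : ℕ) (w : FreeMonoid X) :
    f.coeff (w * FreeMonoid.of c * FreeMonoid.of a ^ n) = 0 := by
  have hcoeff (v : FreeMonoid X) := congrArg (fun g => g.coeff (FreeMonoid.of a * v)) h.eq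
  simp only [MonoidAlgebra.of_apply] at hcoeff
  have hleft (v : FreeMonoid X) : (MonoidAlgebra.single (FreeMonoid.of a) 1 * f).coeff
      (FreeMonoid.of a * v) = f.coeff v := by
    rw [MonoidAlgebra.coeff_single_mul_eq_mul_coeff v (by simp), one_mul]
  induction n generalizing w with
  | zero =>
    rw [← hleft, ← hcoeff, MonoidAlgebra.coeff_mul_single_of_forall_mul_ne]
    intro d hd
    rw [pow_zero, mul_one, ← mul_assoc] at hd
    have := congrArg List.getLast? (congrArg FreeMonoid.toList hd)
    simp only [FreeMonoid.toList_mul, FreeMonoid.toList_of, List.getLast?_concat,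
      Option.some.injEq] at this
    exact hc this.symm
  | succ n ih =>
    rw [← hleft, ← hcoeff, pow_succ, MonoidAlgebra.coeff_mul_single_eq_coeff_mul
      (FreeMonoid.of a * w * FreeMonoid.of c * FreeMonoid.of a ^ n), mul_one, mul_assoc, mul_assoc,
      ← mul_assoc, ← mul_assoc, ih]
    intro m _
    simp only [← mul_assoc, mul_left_inj]

lemma FreeMonoid.eq_pow_or_exists_eq {X : Type*} (a : X) (w : FreeMonoid X) :
    (∃ n : ℕ, w = FreeMonoid.of a ^ n) ∨
      ∃ v c, c ≠ a ∧ ∃ n : ℕ, w = v * FreeMonoid.of c * FreeMonoid.of a ^ n := by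
  induction w using FreeMonoid.inductionOn' with
  | one => exact .inl ⟨0, rfl⟩
  | of_mul x w ih =>
    rcases ih with ⟨n, rfl⟩ | ⟨v, c, hc, n, rfl⟩
    · by_cases h : x = a
      · exact .inl ⟨n + 1, by rw [h, pow_succ']⟩
      · exact .inr ⟨1, x, h, n, by rw [one_mul]⟩
    · exact .inr ⟨FreeMonoid.of x * v, c, hc, n, by simp only [mul_assoc]⟩

/-- The endomorphism of the algebra of words killing every letter except `a` fixes each element
that commutes with `a`. -/
lemma lift_eq_self_of_commute_of {K X : Type*} [CommRing K] [DecidableEq X] {a : X}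
    {f : MonoidAlgebra K (FreeMonoid X)}
    (h : Commute f (MonoidAlgebra.of K (FreeMonoid X) (FreeMonoid.of a))) :
    MonoidAlgebra.lift K (MonoidAlgebra K (FreeMonoid X)) (FreeMonoid X)
      (FreeMonoid.lift fun x => if x = a then
        MonoidAlgebra.of K (FreeMonoid X) (FreeMonoid.of a) else 0) f = f := by
  rw [MonoidAlgebra.lift_apply]
  conv_rhs => rw [← MonoidAlgebra.sum_coeff_single f]
  refine Finsupp.sum_congr fun w hw => ?_
  rcases FreeMonoid.eq_pow_or_exists_eq a w with ⟨n, rfl⟩ | ⟨v, c, hc, n, rfl⟩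
  · simp
  · exact absurd (coeff_eq_zero_of_commute_of h hc n v) (Finsupp.mem_support_iff.1 hw)

/-- The endomorphism of the free Lie algebra killing every generator except `a`, in the form
`u ↦ ε u • of a`. -/
noncomputable def FreeLieAlgebra.retract (K : Type*) {X : Type*} [CommRing K] [DecidableEq X]
    (a : X) : FreeLieAlgebra K X →ₗ⁅K⁆ FreeLieAlgebra K X :=
  { (FreeLieAlgebra.lift K fun x => if x = a then (1 : K) else 0).toLinearMap.smulRight
      (FreeLieAlgebra.of K a) with
    map_lie' := by
      intro u v
      simp [Ring.lie_def, mul_comm] }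

lemma FreeLieAlgebra.exists_retract_eq_smul {K X : Type*} [CommRing K] [DecidableEq X]
    (a : X) (u : FreeLieAlgebra K X) :
    ∃ α : K, FreeLieAlgebra.retract K a u = α • FreeLieAlgebra.of K a :=
  ⟨_, rfl⟩

lemma FreeLieAlgebra.retract_of {K X : Type*} [CommRing K] [DecidableEq X] (a x : X) :
    FreeLieAlgebra.retract K a (FreeLieAlgebra.of K x) =
      if x = a then FreeLieAlgebra.of K a else 0 := by
  change FreeLieAlgebra.lift K (L := K) _ _ • FreeLieAlgebra.of K a = _
  simp

end FreeLieAlgebra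

theorem free_lie_centralizer_of_generator {K : Type*} [Field K] {X : Type*} (a : X)
    (u : FreeLieAlgebra K X) :
    ⁅u, FreeLieAlgebra.of K a⁆ = 0 ↔ ∃ α : K, u = α • FreeLieAlgebra.of K a := by
  classical
  refine ⟨fun h => ?_, fun ⟨α, hα⟩ => by rw [hα, smul_lie, lie_self, smul_zero]⟩
  let _ : LieRing (MonoidAlgebra K (FreeMonoid X)) := LieRing.ofAssociativeRing
  let φ := FreeLieAlgebra.lift K fun x : X => MonoidAlgebra.of K (FreeMonoid X) (FreeMonoid.of x)
  let F : MonoidAlgebra K (FreeMonoid X) →ₐ[K] MonoidAlgebra K (FreeMonoid X) :=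
    MonoidAlgebra.lift K (MonoidAlgebra K (FreeMonoid X)) (FreeMonoid X)
      (FreeMonoid.lift fun x => if x = a then
        MonoidAlgebra.of K (FreeMonoid X) (FreeMonoid.of a) else 0)
  have hcomm : Commute (φ u) (MonoidAlgebra.of K (FreeMonoid X) (FreeMonoid.of a)) := by
    have hφ : ⁅φ u, φ (FreeLieAlgebra.of K a)⁆ = 0 := by rw [← LieHom.map_lie, h, map_zero]
    rw [FreeLieAlgebra.lift_of_apply] at hφ
    exact sub_eq_zero.1 hφ
  have hF : φ.comp (FreeLieAlgebra.retract K a) = F.toLieHom.comp φ := by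
    ext1 x
    simp only [LieHom.comp_apply, FreeLieAlgebra.retract_of, φ, FreeLieAlgebra.lift_of_apply, F]
    by_cases hx : x = a <;> simp [hx]
  have hu : FreeLieAlgebra.retract K a u = u := by
    apply FreeLieAlgebra.lift_monoidAlgebra_injective K X
    exact (LieHom.congr_fun hF u).trans (lift_eq_self_of_commute_of hcomm)
  rw [← hu]
  exact FreeLieAlgebra.exists_retract_eq_smul a u
end

section
/- Let L be the free Lie algebra over a field K on a set X with distinct elements a₁, ..., aₙ (n ≥ 2). If z ∈ L satisfies ⁅z, ι(aᵢ)⁆ = 0 for all i = 1, ..., n, then z = 0; i.e., the common annihilator of the generators is trivial. -/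
attribute [local instance] LieRing.ofAssociativeRing

namespace FreeLieAlgebra

variable {K : Type*} [Field K]

section Filtration

variable {X : Type*}

variable (K) in
/-- `IsMonomial K wt n t` says that `t` is an iterated bracket of generators whose weights
add up to `n`. -/
inductive IsMonomial (wt : X → ℕ) : ℕ → FreeLieAlgebra K X → Prop
  | gen (x : X) : IsMonomial wt (wt x) (FreeLieAlgebra.of K x)
  | lie {m n : ℕ} {s t : FreeLieAlgebra K X} :
      IsMonomial wt m s → IsMonomial wt n t → IsMonomial wt (m + n) ⁅s, t⁆

variable (K) in
/-- The span of the monomials of weight at most `N`. -/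
noncomputable def weightLE (wt : X → ℕ) (N : ℕ) : Submodule K (FreeLieAlgebra K X) :=
  Submodule.span K {t | ∃ n ≤ N, IsMonomial K wt n t}

variable {wt : X → ℕ}

theorem IsMonomial.mem_weightLE {n : ℕ} {t : FreeLieAlgebra K X} (h : IsMonomial K wt n t) :
    t ∈ weightLE K wt n :=
  Submodule.subset_span ⟨n, le_rfl, h⟩

theorem weightLE_mono {m n : ℕ} (h : m ≤ n) : weightLE K wt m ≤ weightLE K wt n :=
  Submodule.span_mono fun _ ⟨k, hk, ht⟩ => ⟨k, hk.trans h, ht⟩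

theorem lie_mem_weightLE {m n : ℕ} {s t : FreeLieAlgebra K X} (hs : s ∈ weightLE K wt m)
    (ht : t ∈ weightLE K wt n) : ⁅s, t⁆ ∈ weightLE K wt (m + n) := by
  induction hs using Submodule.span_induction with
  | mem s hs =>
    obtain ⟨m', hm, hs⟩ := hs
    induction ht using Submodule.span_induction with
    | mem t ht =>
      obtain ⟨n', hn, ht⟩ := ht
      exact weightLE_mono (Nat.add_le_add hm hn) (hs.lie ht).mem_weightLE
    | zero => simp
    | add x y _ _ hx hy => rw [lie_add]; exact add_mem hx hy
    | smul c x _ hx => rw [lie_smul]; exact Submodule.smul_mem _ c hx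
  | zero => simp
  | add x y _ _ hx hy => rw [add_lie]; exact add_mem hx hy
  | smul c x _ hx => rw [smul_lie]; exact Submodule.smul_mem _ c hx

theorem IsMonomial.le_weight {k : ℕ} (hk : ∀ x, k ≤ wt x) {n : ℕ} {t : FreeLieAlgebra K X}
    (h : IsMonomial K wt n t) : k ≤ n := by
  induction h with
  | gen x => exact hk x
  | lie _ _ hs _ => omega

theorem weightLE_eq_bot {N : ℕ} (h : ∀ x, N < wt x) : weightLE K wt N = ⊥ := by
  rw [weightLE, Submodule.span_eq_bot]
  rintro t ⟨n, hn, ht⟩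
  have := ht.le_weight (k := N + 1) h
  omega

/-- A Lie subalgebra containing all generators is everything. -/
theorem mem_of_of_mem (S : LieSubalgebra K (FreeLieAlgebra K X))
    (hS : ∀ x, FreeLieAlgebra.of K x ∈ S) (z : FreeLieAlgebra K X) : z ∈ S := by
  have h : S.incl.comp (lift K fun x => (⟨of K x, hS x⟩ : S)) = LieHom.id := by
    ext x
    simp
  have hz := LieHom.congr_fun h z
  simp only [LieHom.comp_apply, LieHom.id_apply] at hz
  rw [← hz]
  exact SetLike.coe_mem _

/-- Every element involves finitely many generators and is of bounded weight as soon as these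
have weight one. -/
theorem exists_mem_weightLE (z : FreeLieAlgebra K X) :
    ∃ (S : Set X) (N : ℕ), S.Finite ∧
      ∀ wt : X → ℕ, (∀ x ∈ S, wt x = 1) → z ∈ weightLE K wt N := by
  let A : LieSubalgebra K (FreeLieAlgebra K X) :=
    { carrier := {z | ∃ (S : Set X) (N : ℕ), S.Finite ∧
        ∀ wt : X → ℕ, (∀ x ∈ S, wt x = 1) → z ∈ weightLE K wt N}
      zero_mem' := ⟨∅, 0, Set.finite_empty, fun _ _ => zero_mem _⟩
      add_mem' := by
        rintro s t ⟨S, M, hS, hs⟩ ⟨T, N, hT, ht⟩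
        refine ⟨S ∪ T, M + N, hS.union hT, fun wt hwt => add_mem ?_ ?_⟩
        · exact weightLE_mono (by omega) (hs wt fun x hx => hwt x (Or.inl hx))
        · exact weightLE_mono (by omega) (ht wt fun x hx => hwt x (Or.inr hx))
      smul_mem' := by
        rintro c s ⟨S, M, hS, hs⟩
        exact ⟨S, M, hS, fun wt hwt => Submodule.smul_mem _ c (hs wt hwt)⟩
      lie_mem' := by
        rintro s t ⟨S, M, hS, hs⟩ ⟨T, N, hT, ht⟩
        exact ⟨S ∪ T, M + N, hS.union hT, fun wt hwt => lie_mem_weightLE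
          (hs wt fun x hx => hwt x (Or.inl hx)) (ht wt fun x hx => hwt x (Or.inr hx))⟩ }
  refine mem_of_of_mem A (fun x => ⟨{x}, 1, Set.finite_singleton x, fun wt hwt => ?_⟩) z
  have := (IsMonomial.gen (K := K) (wt := wt) x).mem_weightLE
  rwa [hwt x rfl] at this

end Filtration

section Elimination

variable {X : Type*}

/-- The alphabet obtained by eliminating `a`: the pair `(n, x)` stands for `(ad a)ⁿ x`. -/
abbrev ElimAlphabet (a : X) : Type _ := ℕ × {x : X // x ≠ a}

/-- The weight of `(ad a)ⁿ x`. -/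
def elimWeight (wt : X → ℕ) (a : X) (y : ElimAlphabet a) : ℕ := y.1 * wt a + wt y.2

variable (K) in
/-- The homomorphism sending `(n, x)` to `(ad a)ⁿ x`. -/
noncomputable def elimHom (a : X) : FreeLieAlgebra K (ElimAlphabet a) →ₗ⁅K⁆ FreeLieAlgebra K X :=
  lift K fun y => (fun t => ⁅of K a, t⁆)^[y.1] (of K (y.2 : X))

theorem elimHom_of_succ (a : X) (n : ℕ) (x : {x : X // x ≠ a}) :
    elimHom K a (of K (n + 1, x)) = ⁅of K a, elimHom K a (of K (n, x))⁆ := by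
  simp only [elimHom, lift_of_apply, Function.iterate_succ_apply']

theorem elimHom_of_zero (a : X) (x : {x : X // x ≠ a}) :
    elimHom K a (of K (0, x)) = of K (x : X) := by
  simp only [elimHom, lift_of_apply, Function.iterate_zero, id]

variable {wt : X → ℕ} {a : X}

theorem IsMonomial.exists_lie_elimHom {n : ℕ} {t : FreeLieAlgebra K (ElimAlphabet a)}
    (h : IsMonomial K (elimWeight wt a) n t) :
    ∃ w ∈ weightLE K (elimWeight wt a) (n + wt a), ⁅of K a, elimHom K a t⁆ = elimHom K a w := by
  induction h with
  | gen y =>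
    obtain ⟨n, x⟩ := y
    refine ⟨of K (n + 1, x), ?_, (elimHom_of_succ a n x).symm⟩
    have := (IsMonomial.gen (K := K) (wt := elimWeight wt a) (n + 1, x)).mem_weightLE
    refine weightLE_mono (le_of_eq ?_) this
    simp only [elimWeight]
    ring
  | @lie m n s t hs ht ihs iht =>
    obtain ⟨u, hu, hsu⟩ := ihs
    obtain ⟨v, hv, htv⟩ := iht
    refine ⟨⁅u, t⁆ + ⁅s, v⁆, add_mem ?_ ?_, ?_⟩
    · exact weightLE_mono (by omega) (lie_mem_weightLE hu ht.mem_weightLE)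
    · exact weightLE_mono (by omega) (lie_mem_weightLE hs.mem_weightLE hv)
    · rw [LieHom.map_lie, leibniz_lie, hsu, htv, map_add, LieHom.map_lie, LieHom.map_lie]

theorem exists_lie_elimHom {N : ℕ} {t : FreeLieAlgebra K (ElimAlphabet a)}
    (h : t ∈ weightLE K (elimWeight wt a) N) :
    ∃ w ∈ weightLE K (elimWeight wt a) (N + wt a), ⁅of K a, elimHom K a t⁆ = elimHom K a w := by
  induction h using Submodule.span_induction with
  | mem t ht =>
    obtain ⟨n, hn, ht⟩ := ht
    obtain ⟨w, hw, h⟩ := ht.exists_lie_elimHom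
    exact ⟨w, weightLE_mono (by omega) hw, h⟩
  | zero => exact ⟨0, zero_mem _, by simp⟩
  | add s t _ _ hs ht =>
    obtain ⟨u, hu, hsu⟩ := hs
    obtain ⟨v, hv, htv⟩ := ht
    exact ⟨u + v, add_mem hu hv, by rw [map_add, map_add, lie_add, hsu, htv]⟩
  | smul c s _ hs =>
    obtain ⟨u, hu, hsu⟩ := hs
    exact ⟨c • u, Submodule.smul_mem _ c hu, by rw [map_smul, map_smul, lie_smul, hsu]⟩

theorem exists_smul_lie_elimHom {m n : ℕ} {c : K} (hc : c = 0 ∨ wt a ≤ m)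
    {t : FreeLieAlgebra K (ElimAlphabet a)} (h : t ∈ weightLE K (elimWeight wt a) n) :
    ∃ w ∈ weightLE K (elimWeight wt a) (m + n),
      c • ⁅of K a, elimHom K a t⁆ = elimHom K a w := by
  rcases hc with rfl | hc
  · exact ⟨0, zero_mem _, by simp⟩
  · obtain ⟨w, hw, e⟩ := exists_lie_elimHom h
    exact ⟨c • w, Submodule.smul_mem _ c (weightLE_mono (by omega) hw), by rw [e, map_smul]⟩

theorem IsMonomial.exists_eq_smul_add_elimHom {n : ℕ} {t : FreeLieAlgebra K X}
    (h : IsMonomial K wt n t) :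
    ∃ (c : K), ∃ w ∈ weightLE K (elimWeight wt a) n,
      (c = 0 ∨ wt a ≤ n) ∧ t = c • of K a + elimHom K a w := by
  induction h with
  | gen x =>
    by_cases hx : x = a
    · subst hx
      exact ⟨1, 0, zero_mem _, Or.inr le_rfl, by simp⟩
    · refine ⟨0, of K (0, ⟨x, hx⟩), ?_, Or.inl rfl, by rw [elimHom_of_zero]; simp⟩
      have := (IsMonomial.gen (K := K) (wt := elimWeight wt a) (0, ⟨x, hx⟩)).mem_weightLE
      simpa [elimWeight] using this
  | @lie m n s t hs ht ihs iht =>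
    obtain ⟨c, u, hu, hc, rfl⟩ := ihs
    obtain ⟨d, v, hv, hd, rfl⟩ := iht
    obtain ⟨p, hp, ep⟩ := exists_smul_lie_elimHom hc hv
    obtain ⟨q, hq, eq⟩ := exists_smul_lie_elimHom hd hu
    refine ⟨0, p - q + ⁅u, v⁆, add_mem (sub_mem hp (weightLE_mono (by omega) hq))
      (lie_mem_weightLE hu hv), Or.inl rfl, ?_⟩
    rw [map_add, map_sub, ← ep, ← eq, LieHom.map_lie, ← lie_skew (of K a) (elimHom K a u)]
    simp only [add_lie, lie_add, smul_lie, lie_smul, lie_self, smul_zero, smul_neg,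
      zero_smul, zero_add]
    abel

theorem exists_eq_smul_add_elimHom {N : ℕ} {z : FreeLieAlgebra K X}
    (h : z ∈ weightLE K wt N) :
    ∃ (c : K), ∃ w ∈ weightLE K (elimWeight wt a) N, z = c • of K a + elimHom K a w := by
  induction h using Submodule.span_induction with
  | mem t ht =>
    obtain ⟨n, hn, ht⟩ := ht
    obtain ⟨c, w, hw, -, h⟩ := ht.exists_eq_smul_add_elimHom (a := a)
    exact ⟨c, w, weightLE_mono hn hw, h⟩
  | zero => exact ⟨0, 0, zero_mem _, by simp⟩
  | add s t _ _ hs ht =>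
    obtain ⟨c, u, hu, rfl⟩ := hs
    obtain ⟨d, v, hv, rfl⟩ := ht
    exact ⟨c + d, u + v, add_mem hu hv, by rw [map_add, add_smul]; abel⟩
  | smul c s _ hs =>
    obtain ⟨d, u, hu, rfl⟩ := hs
    exact ⟨c * d, c • u, Submodule.smul_mem _ c hu, by rw [map_smul, smul_add, mul_smul]⟩

end Elimination

section FreeAlgebra

variable (K) in
/-- The canonical map from the free Lie algebra to the free associative algebra. -/
noncomputable def toFreeAlgebra (X : Type*) : FreeLieAlgebra K X →ₗ⁅K⁆ FreeAlgebra K X :=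
  lift K (FreeAlgebra.ι K)

@[simp]
theorem toFreeAlgebra_of {X : Type*} (x : X) :
    toFreeAlgebra K X (of K x) = FreeAlgebra.ι K x :=
  lift_of_apply _ _

/-- A map on the alphabet extends to a derivation of the free associative algebra. -/
theorem exists_derivation_freeAlgebra {Y : Type*} (f : Y → FreeAlgebra K Y) :
    ∃ D : Module.End K (FreeAlgebra K Y), (∀ y, D (FreeAlgebra.ι K y) = f y) ∧ D 1 = 0 ∧
      ∀ s t, D (s * t) = D s * t + s * D t := by
  let Φ : FreeAlgebra K Y →ₐ[K] TrivSqZeroExt (FreeAlgebra K Y) (FreeAlgebra K Y) :=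
    FreeAlgebra.lift K fun y => TrivSqZeroExt.inl (FreeAlgebra.ι K y) + TrivSqZeroExt.inr (f y)
  have hfst : ∀ s, (Φ s).fst = s := by
    intro s
    have : (TrivSqZeroExt.fstHom K (FreeAlgebra K Y) (FreeAlgebra K Y)).comp Φ =
        AlgHom.id K _ := by
      ext y
      simp [Φ]
    exact DFunLike.congr_fun this s
  refine ⟨(TrivSqZeroExt.sndHom (FreeAlgebra K Y) (FreeAlgebra K Y)).restrictScalars K ∘ₗ
    Φ.toLinearMap, fun y => ?_, ?_, fun s t => ?_⟩
  · simp [Φ]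
  · simp
  · simp [hfst, add_comm]

/-- Elimination reflects the kernel of the map to the free associative algebra. -/
theorem toFreeAlgebra_eq_zero_of_elim {X : Type*} {a : X} (c : K)
    (w : FreeLieAlgebra K (ElimAlphabet a))
    (h : toFreeAlgebra K X (c • of K a + elimHom K a w) = 0) :
    toFreeAlgebra K (ElimAlphabet a) w = 0 := by
  classical
  obtain ⟨D, hD, hD1, hmul⟩ := exists_derivation_freeAlgebra (K := K)
    fun y : ElimAlphabet a => FreeAlgebra.ι K (y.1 + 1, y.2)
  let ρ : FreeAlgebra K X →ₐ[K] Module.End K (FreeAlgebra K (ElimAlphabet a)) :=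
    FreeAlgebra.lift K fun x => if hx : x = a then D else
      LinearMap.mulLeft K (FreeAlgebra.ι K ((0, ⟨x, hx⟩) : ElimAlphabet a))
  have hρa : ρ (FreeAlgebra.ι K a) = D := by simp [ρ]
  have hlie : ∀ s, ⁅D, LinearMap.mulLeft K s⁆ = LinearMap.mulLeft K (D s) := by
    intro s
    ext t
    simp [LieRing.of_associative_ring_bracket, hmul]
  have hcomp : (AlgHom.toLieHom ρ).comp ((toFreeAlgebra K X).comp (elimHom K a)) =
      (AlgHom.toLieHom (Algebra.lmul K _)).comp (toFreeAlgebra K (ElimAlphabet a)) := by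
    ext1 y
    obtain ⟨n, x⟩ := y
    induction n with
    | zero =>
      simp only [LieHom.comp_apply, elimHom_of_zero, toFreeAlgebra_of, AlgHom.toLieHom_apply, ρ,
        FreeAlgebra.lift_ι_apply, dif_neg x.2]
      rfl
    | succ n ih =>
      simp only [LieHom.comp_apply, elimHom_of_succ, LieHom.map_lie, toFreeAlgebra_of] at ih ⊢
      rw [ih, AlgHom.toLieHom_apply, hρa]
      exact (hlie _).trans (congrArg _ (hD _))
  have h1 := congrArg (fun s => ρ s 1) h
  have h2 := congrArg (fun φ => φ 1) (LieHom.congr_fun hcomp w)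
  simp only [LieHom.comp_apply, AlgHom.toLieHom_apply] at h2
  simp only [map_add, map_smul, toFreeAlgebra_of, hρa, LinearMap.add_apply, LinearMap.smul_apply,
    hD1, smul_zero, zero_add, map_zero, LinearMap.zero_apply, h2] at h1
  simpa using h1

theorem finite_elimWeight_le {X : Type*} {wt : X → ℕ} {a : X} {N : ℕ}
    (hfin : {x | wt x ≤ N}.Finite) (ha : 1 ≤ wt a) : {y | elimWeight wt a y ≤ N}.Finite := by
  refine ((Set.finite_Iic N).prod (hfin.preimage Subtype.val_injective.injOn)).subset ?_
  rintro ⟨n, x⟩ hy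
  simp only [elimWeight, Set.mem_ofPred_eq] at hy
  have : n * 1 ≤ n * wt a := Nat.mul_le_mul_left n ha
  exact ⟨by simp only [Set.mem_Iic]; omega,
    by simp only [Set.mem_preimage, Set.mem_ofPred_eq]; omega⟩

/-- Eliminating a generator of minimal weight lowers the number of generators of that weight. -/
theorem ncard_elimWeight_lt {X : Type*} {wt : X → ℕ} {a : X} (hfin : {x | wt x = wt a}.Finite)
    (ha : 1 ≤ wt a) (hmin : ∀ x, wt a ≤ wt x) :
    {y | elimWeight wt a y = wt a}.ncard < {x | wt x = wt a}.ncard := by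
  have key : ∀ y ∈ {y | elimWeight wt a y = wt a}, y.1 = 0 ∧ wt y.2 = wt a := by
    rintro ⟨n, x⟩ hy
    simp only [elimWeight, Set.mem_ofPred_eq] at hy
    have : n * 1 ≤ n * wt a := Nat.mul_le_mul_left n ha
    have := hmin x
    exact ⟨by simp only; omega, by simp only; omega⟩
  refine lt_of_le_of_lt (Set.ncard_le_ncard_of_injOn (t := {x | wt x = wt a} \ {a})
    (fun y => (y.2 : X)) (fun y hy => ⟨(key y hy).2, y.2.2⟩) ?_ (hfin.subset Set.sdiff_subset))
    (Set.ncard_sdiff_singleton_lt_of_mem rfl hfin)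
  intro y hy y' hy' h
  exact Prod.ext ((key y hy).1.trans (key y' hy').1.symm) (Subtype.ext h)

/-- The kernel of the map to the free associative algebra contains no nonzero element of weight
at most `N`; the induction is on the gap `k` between `N + 1` and the least weight of a generator,
and on the number `c` of generators of that weight. -/
theorem eq_zero_of_mem_weightLE (N k c : ℕ) {X : Type*} (wt : X → ℕ)
    (hfin : {x | wt x ≤ N}.Finite) (hgap : ∀ x, N + 1 ≤ wt x + k) (hpos : ∀ x, 1 ≤ wt x)
    (hcard : {x | wt x + k = N + 1}.ncard ≤ c) (z : FreeLieAlgebra K X)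
    (hz : z ∈ weightLE K wt N) (h : toFreeAlgebra K X z = 0) : z = 0 := by
  induction k generalizing c X with
  | zero =>
    rw [weightLE_eq_bot fun x => by have := hgap x; omega] at hz
    exact (Submodule.mem_bot K).1 hz
  | succ k ihk =>
    induction c generalizing X with
    | zero =>
      have hfin' : {x | wt x + (k + 1) = N + 1}.Finite :=
        hfin.subset fun x hx => by simp only [Set.mem_ofPred_eq] at hx ⊢; omega
      have hempty := (Set.ncard_eq_zero hfin').1 (Nat.le_zero.1 hcard)
      refine ihk _ wt hfin (fun x => ?_) hpos le_rfl z hz h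
      have h1 := hgap x
      have h2 : ¬ wt x + (k + 1) = N + 1 :=
        Set.eq_empty_iff_forall_notMem.1 hempty x
      omega
    | succ c ihc =>
      by_cases hex : ∃ a, wt a + (k + 1) = N + 1
      · obtain ⟨a, ha⟩ := hex
        have hmin : ∀ x, wt a ≤ wt x := fun x => by have := hgap x; omega
        have hlevel : ∀ m, m + (k + 1) = N + 1 ↔ m = wt a := fun m => by omega
        simp only [hlevel] at hcard
        have hlt := ncard_elimWeight_lt
          (hfin.subset fun x hx => by simp only [Set.mem_ofPred_eq] at hx ⊢; omega) (hpos a) hmin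
        obtain ⟨d, w, hw, rfl⟩ := exists_eq_smul_add_elimHom (a := a) hz
        have hge : ∀ y, wt a ≤ elimWeight wt a y := fun y =>
          (hmin y.2).trans (Nat.le_add_left _ _)
        have hw0 : w = 0 := by
          refine ihc (elimWeight wt a) (finite_elimWeight_le hfin (hpos a))
            (fun y => ?_) (fun y => (hpos a).trans (hge y)) ?_ w hw
            (toFreeAlgebra_eq_zero_of_elim d w h)
          · have := hge y
            omega
          · simp only [hlevel]
            omega
        subst hw0
        simp only [map_zero, add_zero, map_smul, toFreeAlgebra_of, smul_eq_zero,
          FreeAlgebra.ι_ne_zero, or_false] at h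
        simp [h]
      · refine ihc wt hfin hgap hpos ?_ z hz h
        have : {x | wt x + (k + 1) = N + 1} = ∅ :=
          Set.eq_empty_iff_forall_notMem.2 fun x hx => hex ⟨x, hx⟩
        simp [this]

/-- The free Lie algebra over a field embeds into the free associative algebra. -/
theorem toFreeAlgebra_injective (X : Type*) : Function.Injective (toFreeAlgebra K X) := by
  classical
  rw [injective_iff_map_eq_zero]
  intro z hz
  obtain ⟨S, N, hS, hmem⟩ := exists_mem_weightLE z
  let wt : X → ℕ := fun x => if x ∈ S then 1 else N + 1
  refine eq_zero_of_mem_weightLE N N _ wt (hS.subset fun x hx => ?_) (fun x => ?_) (fun x => ?_)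
    le_rfl z (hmem wt fun x hx => if_pos hx) hz
  · by_contra hxS
    simp [wt, hxS] at hx
  · by_cases hx : x ∈ S <;> simp [wt, hx]
  · by_cases hx : x ∈ S <;> simp [wt, hx]

/-- An element of the free associative algebra commuting with two generators is a scalar. -/
theorem exists_algebraMap_of_commute {X : Type*} {a b : X} (hab : a ≠ b) (z : FreeAlgebra K X)
    (ha : Commute z (FreeAlgebra.ι K a)) (hb : Commute z (FreeAlgebra.ι K b)) :
    ∃ c : K, z = algebraMap K _ c := by
  let e : FreeAlgebra K X ≃ₐ[K] MonoidAlgebra K (FreeMonoid X) :=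
    FreeAlgebra.equivMonoidAlgebraFreeMonoid
  have he : ∀ x, e (FreeAlgebra.ι K x) = MonoidAlgebra.single (FreeMonoid.of x) 1 := by
    intro x
    simp [e, FreeAlgebra.equivMonoidAlgebraFreeMonoid, MonoidAlgebra.of_apply]
  have hlast : ∀ (x y : X) (u : FreeMonoid X), x ≠ y → Commute z (FreeAlgebra.ι K x) →
      (e z).coeff (u * FreeMonoid.of y) = 0 := by
    intro x y u hxy hx
    have h := congrArg e hx.eq
    rw [map_mul, map_mul, he] at h
    have h' := congrArg (fun p => p.coeff (FreeMonoid.of x * (u * FreeMonoid.of y))) h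
    beta_reduce at h'
    rw [MonoidAlgebra.coeff_single_mul_eq_mul_coeff (u * FreeMonoid.of y) (by simp),
      MonoidAlgebra.coeff_mul_single_of_forall_mul_ne, one_mul] at h'
    · exact h'.symm
    · intro d hd
      rw [← mul_assoc] at hd
      have hy := congrArg (fun w => (FreeMonoid.toList w).getLast?) hd
      simp only [FreeMonoid.toList_mul, FreeMonoid.toList_of, List.getLast?_concat] at hy
      exact hxy (Option.some.inj hy)
  have hword : ∀ w : FreeMonoid X, w ≠ 1 → (e z).coeff w = 0 := by
    intro w hw
    obtain ⟨u, y, rfl⟩ : ∃ (u : FreeMonoid X) (y : X), w = u * FreeMonoid.of y := by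
      rcases List.eq_nil_or_concat (FreeMonoid.toList w) with h | ⟨l, y, h⟩
      · exact absurd h hw
      · exact ⟨FreeMonoid.ofList l, y, h.trans (List.concat_eq_append)⟩
    by_cases hy : a = y
    · exact hlast b y u (fun h => hab (hy.trans h.symm)) hb
    · exact hlast a y u hy ha
  refine ⟨(e z).coeff 1, e.injective ?_⟩
  rw [AlgEquiv.commutes]
  ext w
  by_cases hw : w = 1
  · subst hw
    simp
  · rw [hword w hw]
    simp [Ne.symm hw]

theorem algebraMapInv_toFreeAlgebra {X : Type*} (z : FreeLieAlgebra K X) :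
    FreeAlgebra.algebraMapInv (toFreeAlgebra K X z) = 0 := by
  have : (AlgHom.toLieHom FreeAlgebra.algebraMapInv).comp (toFreeAlgebra K X) = 0 := by
    ext x
    simp [FreeAlgebra.algebraMapInv]
  exact LieHom.congr_fun this z

end FreeAlgebra

end FreeLieAlgebra

theorem free_lie_trivial_annihilator {K : Type*} [Field K] {X : Type*} (n : ℕ) (hn : 2 ≤ n)
    (a : Fin n → X) (ha : Function.Injective a) (z : FreeLieAlgebra K X)
    (h : ∀ i : Fin n, ⁅z, FreeLieAlgebra.of K (a i)⁆ = 0) :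
    z = 0 := by
  have hcomm : ∀ i, Commute (FreeLieAlgebra.toFreeAlgebra K X z) (FreeAlgebra.ι K (a i)) := by
    intro i
    have hi := congrArg (FreeLieAlgebra.toFreeAlgebra K X) (h i)
    rw [LieHom.map_lie, map_zero, FreeLieAlgebra.toFreeAlgebra_of,
      LieRing.of_associative_ring_bracket, sub_eq_zero] at hi
    exact hi
  have hne : a ⟨0, by omega⟩ ≠ a ⟨1, by omega⟩ := ha.ne (by simp)
  obtain ⟨c, hc⟩ := FreeLieAlgebra.exists_algebraMap_of_commute hne _ (hcomm _) (hcomm _)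
  have hc0 := FreeLieAlgebra.algebraMapInv_toFreeAlgebra z
  rw [hc, FreeAlgebra.algebraMap_leftInverse] at hc0
  apply FreeLieAlgebra.toFreeAlgebra_injective X
  rw [hc, hc0, map_zero, map_zero]
end

section
/- Let L be the free Lie algebra over a field K on a set X with distinct elements a₁, a₂. For x, z ∈ L and y₁ = α • ι(a₁), y₂ = α • ι(a₂) with α ∈ K: if ⁅z, ι(a₁)⁆ = ⁅x, y₁⁆ and ⁅z, ι(a₂)⁆ = ⁅x, y₂⁆, then z = α • x. -/
/-- The number of inversions of a word over a linearly ordered alphabet. -/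
def List.inversionCount {ι : Type*} [LinearOrder ι] : List ι → ℕ
  | [] => 0
  | x :: l => l.countP (· < x) + inversionCount l

theorem List.inversionCount_swap_lt {ι : Type*} [LinearOrder ι] (u v : List ι) {i j : ι}
    (h : j < i) :
    (u ++ j :: i :: v).inversionCount < (u ++ i :: j :: v).inversionCount := by
  induction u with
  | nil => simp [inversionCount, h, h.not_gt]; omega
  | cons x u ih =>
    simp only [List.cons_append, inversionCount, List.countP_append, List.countP_cons]
    omega

namespace Module.Basis

variable {R L ι : Type*} [CommRing R] [LieRing L] [LieAlgebra R L] [LinearOrder ι]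

open Classical in
/-- The linear part of the straightening of a word in the letters of an ordered basis `b` of a Lie
algebra: descents `i > j` are rewritten through `b i * b j = b j * b i + ⁅b i, b j⁆`, and of
the resulting combination of nondecreasing words only those of length one are kept. -/
noncomputable def straighten (b : Basis ι R L) (l : List ι) : L :=
  if h : ∃ p : List ι × ι × ι × List ι,
      l = p.1 ++ p.2.1 :: p.2.2.1 :: p.2.2.2 ∧ p.2.2.1 < p.2.1 then
    straighten b (h.choose.1 ++ h.choose.2.2.1 :: h.choose.2.1 :: h.choose.2.2.2) +
      b.constr R (fun k ↦ straighten b (h.choose.1 ++ k :: h.choose.2.2.2))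
        ⁅b h.choose.2.1, b h.choose.2.2.1⁆
  else
    match l with
    | [i] => b i
    | _ => 0
termination_by (l.length, l.inversionCount)
decreasing_by
  · have hl := congrArg List.length h.choose_spec.1
    have hi := congrArg List.inversionCount h.choose_spec.1
    have := List.inversionCount_swap_lt h.choose.1 h.choose.2.2.2 h.choose_spec.2
    simp only [List.length_append, List.length_cons] at hl
    rw [Prod.lex_def]
    right
    simp only [List.length_append, List.length_cons]
    omega
  · have hl := congrArg List.length h.choose_spec.1
    simp only [List.length_append, List.length_cons] at hl
    rw [Prod.lex_def]
    left
    simp only [List.length_append, List.length_cons]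
    omega

variable (b : Basis ι R L)

/-- The straightening of a word in which one letter is replaced by an element of `L`. -/
noncomputable def straightenInsert (u v : List ι) : L →ₗ[R] L :=
  b.constr R fun k ↦ straighten b (u ++ k :: v)

/-- The straightening of a word in which two letters are replaced by elements of `L`. -/
noncomputable def straightenInsert₂ (u m v : List ι) : L →ₗ[R] L →ₗ[R] L :=
  b.constr R fun k ↦ straightenInsert b (u ++ k :: m) v

@[simp]
theorem straightenInsert_basis (u v : List ι) (k : ι) :
    straightenInsert b u v (b k) = straighten b (u ++ k :: v) := by
  simp [straightenInsert]

theorem straightenInsert₂_basis_left (u m v : List ι) (k : ι) (y : L) :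
    straightenInsert₂ b u m v (b k) y = straightenInsert b (u ++ k :: m) v y := by
  simp [straightenInsert₂]

theorem straightenInsert₂_basis_right (u m v : List ι) (x : L) (k : ι) :
    straightenInsert₂ b u m v x (b k) = straightenInsert b u (m ++ k :: v) x := by
  have : (straightenInsert₂ b u m v).flip (b k) = straightenInsert b u (m ++ k :: v) :=
    b.ext fun i ↦ by simp [straightenInsert₂_basis_left]
  exact congr($this x)

theorem straighten_singleton (i : ι) : straighten b [i] = b i := by
  rw [straighten, dif_neg]
  rintro ⟨p, hp, -⟩
  have := congrArg List.length hp
  simp at this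
  omega

theorem straighten_eq_of_exists_descent {u v : List ι} {i j : ι} (h : j < i) :
    ∃ u' i' j' v', j' < i' ∧ u ++ i :: j :: v = u' ++ i' :: j' :: v' ∧
      straighten b (u ++ i :: j :: v) =
        straighten b (u' ++ j' :: i' :: v') + straightenInsert b u' v' ⁅b i', b j'⁆ := by
  have hex : ∃ p : List ι × ι × ι × List ι,
      u ++ i :: j :: v = p.1 ++ p.2.1 :: p.2.2.1 :: p.2.2.2 ∧ p.2.2.1 < p.2.1 :=
    ⟨(u, i, j, v), rfl, h⟩
  refine ⟨_, _, _, _, hex.choose_spec.2, hex.choose_spec.1, ?_⟩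
  rw [straighten, dif_pos hex]
  rfl

/-- The straightening relation for an arbitrary pair of letters follows from the one for
descents. -/
theorem straighten_swap_of_descent {u v : List ι}
    (H : ∀ i j, j < i → straighten b (u ++ i :: j :: v) =
      straighten b (u ++ j :: i :: v) + straightenInsert b u v ⁅b i, b j⁆) (i j : ι) :
    straighten b (u ++ i :: j :: v) =
      straighten b (u ++ j :: i :: v) + straightenInsert b u v ⁅b i, b j⁆ := by
  rcases lt_trichotomy i j with h | rfl | h
  · rw [H j i h, ← lie_skew, map_neg]; abel
  · simp
  · exact H i j h

/-- Bilinear form of the straightening relation. -/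
theorem straightenInsert₂_sub_swap {u v : List ι}
    (H : ∀ i j, straighten b (u ++ i :: j :: v) =
      straighten b (u ++ j :: i :: v) + straightenInsert b u v ⁅b i, b j⁆) (x y : L) :
    straightenInsert₂ b u [] v x y =
      straightenInsert₂ b u [] v y x + straightenInsert b u v ⁅x, y⁆ := by
  have : straightenInsert₂ b u [] v = (straightenInsert₂ b u [] v).flip +
      ((LieModule.toEnd R L L : L →ₗ[R] End R L)).compr₂ (straightenInsert b u v) :=
    b.ext fun i ↦ b.ext fun j ↦ by
      simpa [straightenInsert₂_basis_left] using H i j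
  exact congr($this x y)

theorem straightenInsert_swap_right {u m v : List ι} {i j : ι}
    (H : ∀ k, straighten b (u ++ k :: (m ++ i :: j :: v)) =
      straighten b (u ++ k :: (m ++ j :: i :: v)) +
        straightenInsert b (u ++ k :: m) v ⁅b i, b j⁆) (x : L) :
    straightenInsert b u (m ++ i :: j :: v) x =
      straightenInsert b u (m ++ j :: i :: v) x + straightenInsert₂ b u m v x ⁅b i, b j⁆ := by
  have : straightenInsert b u (m ++ i :: j :: v) = straightenInsert b u (m ++ j :: i :: v) +
      (straightenInsert₂ b u m v).flip ⁅b i, b j⁆ :=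
    b.ext fun k ↦ by simpa [straightenInsert₂_basis_left] using H k
  exact congr($this x)

theorem straightenInsert_swap_left {u m v : List ι} {i j : ι}
    (H : ∀ k, straighten b (u ++ i :: j :: (m ++ k :: v)) =
      straighten b (u ++ j :: i :: (m ++ k :: v)) +
        straightenInsert b u (m ++ k :: v) ⁅b i, b j⁆) (x : L) :
    straightenInsert b (u ++ i :: j :: m) v x =
      straightenInsert b (u ++ j :: i :: m) v x + straightenInsert₂ b u m v ⁅b i, b j⁆ x := by
  have : straightenInsert b (u ++ i :: j :: m) v = straightenInsert b (u ++ j :: i :: m) v +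
      straightenInsert₂ b u m v ⁅b i, b j⁆ :=
    b.ext fun k ↦ by simpa [straightenInsert₂_basis_right] using H k
  exact congr($this x)

/-- The straightening relation at the descents of words smaller than `l`. -/
def StraightenBelow (l : List ι) : Prop :=
  ∀ u i j v, j < i →
    toLex ((u ++ i :: j :: v).length, (u ++ i :: j :: v).inversionCount) <
      toLex (l.length, l.inversionCount) →
    straighten b (u ++ i :: j :: v) =
      straighten b (u ++ j :: i :: v) + straightenInsert b u v ⁅b i, b j⁆

variable {b}

theorem StraightenBelow.of_length_lt {l : List ι} (H : StraightenBelow b l) {u v : List ι}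
    (h : u.length + v.length + 2 < l.length) (i j : ι) :
    straighten b (u ++ i :: j :: v) =
      straighten b (u ++ j :: i :: v) + straightenInsert b u v ⁅b i, b j⁆ := by
  refine straighten_swap_of_descent b (fun i j hij ↦ H u i j v hij ?_) i j
  rw [Prod.Lex.toLex_lt_toLex]
  left
  simp only [List.length_append, List.length_cons]
  omega

theorem StraightenBelow.of_inversionCount_lt {l : List ι} (H : StraightenBelow b l)
    {u v : List ι} {i j : ι} (hij : j < i) (hl : u.length + v.length + 2 = l.length)
    (h : (u ++ i :: j :: v).inversionCount < l.inversionCount) :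
    straighten b (u ++ i :: j :: v) =
      straighten b (u ++ j :: i :: v) + straightenInsert b u v ⁅b i, b j⁆ := by
  refine H u i j v hij ?_
  rw [Prod.Lex.toLex_lt_toLex]
  right
  refine ⟨?_, h⟩
  simp only [List.length_append, List.length_cons]
  omega

/-- Resolution of disjoint descents. -/
theorem StraightenBelow.disjoint {u m v : List ι} {i j k l : ι} (hij : j < i) (hkl : l < k)
    (H : StraightenBelow b (u ++ i :: j :: (m ++ k :: l :: v))) :
    straighten b (u ++ j :: i :: (m ++ k :: l :: v)) +
        straightenInsert b u (m ++ k :: l :: v) ⁅b i, b j⁆ =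
      straighten b ((u ++ i :: j :: m) ++ l :: k :: v) +
        straightenInsert b (u ++ i :: j :: m) v ⁅b k, b l⁆ := by
  have e₁ := H.of_inversionCount_lt (u := u ++ j :: i :: m) (v := v) hkl
    (by simp; omega) (by simpa using List.inversionCount_swap_lt u (m ++ k :: l :: v) hij)
  have e₂ := H.of_inversionCount_lt (u := u) (v := m ++ l :: k :: v) hij
    (by simp; omega) (by simpa using List.inversionCount_swap_lt (u ++ i :: j :: m) v hkl)
  have e₃ := straightenInsert_swap_right b (u := u) (m := m) (v := v) (i := k) (j := l)
    (fun a ↦ by simpa using H.of_length_lt (u := u ++ a :: m) (v := v) (by simp; omega) k l)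
    ⁅b i, b j⁆
  have e₄ := straightenInsert_swap_left b (u := u) (m := m) (v := v) (i := i) (j := j)
    (fun a ↦ H.of_length_lt (by simp; omega) i j) ⁅b k, b l⁆
  simp only [List.append_assoc, List.cons_append] at e₁ e₂ ⊢
  rw [e₁, e₂, e₃, e₄]
  abel

/-- Resolution of overlapping descents, through the Jacobi identity. -/
theorem StraightenBelow.overlap {u v : List ι} {i j k : ι} (hij : j < i) (hjk : k < j)
    (H : StraightenBelow b (u ++ i :: j :: k :: v)) :
    straighten b (u ++ j :: i :: k :: v) + straightenInsert b u (k :: v) ⁅b i, b j⁆ =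
      straighten b ((u ++ [i]) ++ k :: j :: v) +
        straightenInsert b (u ++ [i]) v ⁅b j, b k⁆ := by
  have hik := hjk.trans hij
  have l₁ := List.inversionCount_swap_lt u (k :: v) hij
  have l₂ : (u ++ i :: k :: j :: v).inversionCount < (u ++ i :: j :: k :: v).inversionCount := by
    simpa using List.inversionCount_swap_lt (u ++ [i]) v hjk
  have l₃ : (u ++ j :: k :: i :: v).inversionCount < (u ++ j :: i :: k :: v).inversionCount := by
    simpa using List.inversionCount_swap_lt (u ++ [j]) v hik
  have l₄ := List.inversionCount_swap_lt u (j :: v) hik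
  have e₁ := H.of_inversionCount_lt (u := u ++ [j]) (v := v) hik (by simp; omega) (by simpa)
  have e₂ := H.of_inversionCount_lt (u := u) (v := i :: v) hjk (by simp; omega) (l₃.trans l₁)
  have e₃ := H.of_inversionCount_lt (u := u) (v := j :: v) hik (by simp; omega) l₂
  have e₄ := H.of_inversionCount_lt (u := u ++ [k]) (v := v) hij (by simp; omega)
    (by simpa using l₄.trans l₂)
  have s := straightenInsert₂_sub_swap b (u := u) (v := v) (H.of_length_lt (by simp; omega))
  have s₁ := s ⁅b j, b k⁆ (b i)
  have s₂ := s (b j) ⁅b i, b k⁆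
  have s₃ := s ⁅b i, b j⁆ (b k)
  have jac : ⁅⁅b j, b k⁆, b i⁆ + ⁅b j, ⁅b i, b k⁆⁆ + ⁅⁅b i, b j⁆, b k⁆ = 0 := by
    rw [lie_lie (b i), ← lie_skew _ (b i)]
    abel
  have jac' := congrArg (straightenInsert b u v) jac
  simp only [map_add, map_zero] at jac'
  simp only [straightenInsert₂_basis_left, straightenInsert₂_basis_right, List.nil_append]
    at s₁ s₂ s₃
  simp only [List.append_assoc, List.cons_append, List.nil_append] at e₁ e₂ e₃ e₄ ⊢
  rw [e₁, e₂, e₃, e₄, s₁, s₂, s₃, ← sub_eq_zero, ← jac']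
  abel

variable (b)

theorem straighten_swap_of_lt (u : List ι) (i j : ι) (v : List ι) (hij : j < i) :
    straighten b (u ++ i :: j :: v) =
      straighten b (u ++ j :: i :: v) + straightenInsert b u v ⁅b i, b j⁆ := by
  suffices ∀ (p : ℕ ×ₗ ℕ) (u : List ι) (i j : ι) (v : List ι), j < i →
      toLex ((u ++ i :: j :: v).length, (u ++ i :: j :: v).inversionCount) = p →
      straighten b (u ++ i :: j :: v) =
        straighten b (u ++ j :: i :: v) + straightenInsert b u v ⁅b i, b j⁆ from
    this _ u i j v hij rfl
  intro p
  induction p using WellFoundedLT.induction with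
  | ind p ih =>
  intro u i j v hij hp
  have H : StraightenBelow b (u ++ i :: j :: v) :=
    fun u' i' j' v' hij' h ↦ ih _ (hp ▸ h) u' i' j' v' hij' rfl
  obtain ⟨u', i', j', v', hij', hw, e⟩ := straighten_eq_of_exists_descent b (u := u) (v := v) hij
  rw [e]
  rcases List.append_eq_append_iff.1 hw with ⟨m, rfl, hm⟩ | ⟨m, rfl, hm⟩
  · match m, hm with
    | [], hm => simp at hm; obtain ⟨rfl, rfl, rfl⟩ := hm; simp
    | [a], hm =>
      simp at hm
      obtain ⟨rfl, rfl, rfl⟩ := hm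
      exact (H.overlap hij hij').symm
    | a :: c :: m, hm =>
      simp at hm
      obtain ⟨rfl, rfl, rfl⟩ := hm
      exact (H.disjoint hij hij').symm
  · rw [hw] at H
    match m, hm with
    | [], hm => simp at hm; obtain ⟨rfl, rfl, rfl⟩ := hm; simp
    | [a], hm =>
      simp at hm
      obtain ⟨rfl, rfl, rfl⟩ := hm
      exact H.overlap hij' hij
    | a :: c :: m, hm =>
      simp at hm
      obtain ⟨rfl, rfl, rfl⟩ := hm
      exact H.disjoint hij' hij

theorem straighten_swap (u : List ι) (i j : ι) (v : List ι) :
    straighten b (u ++ i :: j :: v) =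
      straighten b (u ++ j :: i :: v) + straightenInsert b u v ⁅b i, b j⁆ :=
  straighten_swap_of_descent b (fun i j ↦ straighten_swap_of_lt b u i j v) i j


/-- The linear extension of `straighten` to the free associative algebra on the basis. -/
noncomputable def straightenLinear : MonoidAlgebra R (FreeMonoid ι) →ₗ[R] L :=
  Finsupp.linearCombination R (fun w ↦ straighten b (FreeMonoid.toList w)) ∘ₗ
    (MonoidAlgebra.coeffLinearEquiv R).toLinearMap

@[simp]
theorem straightenLinear_single (w : FreeMonoid ι) (r : R) :
    straightenLinear b (MonoidAlgebra.single w r) = r • straighten b (FreeMonoid.toList w) := by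
  simp [straightenLinear]

/-- The inclusion of `L` in degree one of the free associative algebra on its basis. -/
noncomputable def toFreeMonoidAlgebra : L →ₗ[R] MonoidAlgebra R (FreeMonoid ι) :=
  b.constr R fun i ↦ MonoidAlgebra.of R _ (FreeMonoid.of i)

theorem straightenLinear_toFreeMonoidAlgebra (x : L) :
    straightenLinear b (toFreeMonoidAlgebra b x) = x := by
  have : straightenLinear b ∘ₗ toFreeMonoidAlgebra b = LinearMap.id :=
    b.ext fun i ↦ by simp [toFreeMonoidAlgebra, straighten_singleton]
  exact congr($this x)

theorem straightenLinear_word_mul_mul_word (u v : FreeMonoid ι) (x : L) :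
    straightenLinear b (MonoidAlgebra.of R _ u * toFreeMonoidAlgebra b x *
      MonoidAlgebra.of R _ v) = straightenInsert b u.toList v.toList x := by
  have : straightenLinear b ∘ₗ LinearMap.mulLeftRight R
      (MonoidAlgebra.of R _ u, MonoidAlgebra.of R _ v) ∘ₗ toFreeMonoidAlgebra b =
      straightenInsert b u.toList v.toList :=
    b.ext fun i ↦ by simp [toFreeMonoidAlgebra]
  exact congr($this x)

theorem straightenLinear_mul_lie_mul (s t : MonoidAlgebra R (FreeMonoid ι)) (x y : L) :
    straightenLinear b (s * toFreeMonoidAlgebra b ⁅x, y⁆ * t) =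
      straightenLinear b (s * (toFreeMonoidAlgebra b x * toFreeMonoidAlgebra b y -
        toFreeMonoidAlgebra b y * toFreeMonoidAlgebra b x) * t) := by
  induction s using MonoidAlgebra.induction_on with
  | of u =>
    induction t using MonoidAlgebra.induction_on with
    | of v =>
      rw [straightenLinear_word_mul_mul_word]
      have : (LieModule.toEnd R L L : L →ₗ[R] End R L).compr₂
            (straightenInsert b u.toList v.toList) =
          ((LinearMap.mul R (MonoidAlgebra R (FreeMonoid ι)) -
            (LinearMap.mul R (MonoidAlgebra R (FreeMonoid ι))).flip).compl₁₂
            (toFreeMonoidAlgebra b) (toFreeMonoidAlgebra b)).compr₂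
            (straightenLinear b ∘ₗ LinearMap.mulLeftRight R
              (MonoidAlgebra.of R _ u, MonoidAlgebra.of R _ v)) := by
        refine b.ext fun i ↦ b.ext fun j ↦ ?_
        have := straighten_swap b u.toList i j v.toList
        simp [toFreeMonoidAlgebra, mul_sub, sub_mul, this]
      exact congr($this x y)
    | add t₁ t₂ h₁ h₂ => simp only [mul_add, map_add, h₁, h₂]
    | smul r t h => simp only [mul_smul_comm, map_smul, h]
  | add s₁ s₂ h₁ h₂ => simp only [add_mul, map_add, h₁, h₂]
  | smul r s h => simp only [smul_mul_assoc, map_smul, h]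

/-- The largest ring congruence on the free associative algebra that `straightenLinear`
respects. -/
def straightenCon : RingCon (MonoidAlgebra R (FreeMonoid ι)) where
  r p q := ∀ s t, straightenLinear b (s * p * t) = straightenLinear b (s * q * t)
  iseqv := ⟨fun _ _ _ ↦ rfl, fun h s t ↦ (h s t).symm, fun h h' s t ↦ (h s t).trans (h' s t)⟩
  add' h h' s t := by simp only [mul_add, add_mul, map_add, h s t, h' s t]
  mul' {p q p' q'} h h' s t := by
    have e₁ := h s (p' * t)
    have e₂ := h' (s * q) t
    simp only [mul_assoc] at e₁ e₂ ⊢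
    rw [e₁, e₂]

attribute [local instance] LieRing.ofAssociativeRing

/-- `L` as a Lie subalgebra of an associative algebra. -/
noncomputable def toStraightenQuotient : L →ₗ⁅R⁆ (straightenCon b).Quotient :=
  { (RingCon.mkₐ R (straightenCon b)).toLinearMap ∘ₗ toFreeMonoidAlgebra b with
    map_lie' := fun {x y} ↦
      (RingCon.eq (straightenCon b)).2 fun s t ↦ straightenLinear_mul_lie_mul b s t x y }

theorem toStraightenQuotient_injective : Function.Injective (toStraightenQuotient b) := by
  intro x y h
  have := (RingCon.eq (straightenCon b)).1 h 1 1
  simpa [straightenLinear_toFreeMonoidAlgebra] using this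

end Module.Basis

namespace FreeLieAlgebra

attribute [local instance] LieRing.ofAssociativeRing

variable {K X : Type*} [Field K]

variable (K X) in
/-- The free Lie algebra over a field embeds in the free associative algebra. -/
theorem lift_freeAlgebra_ι_injective :
    Function.Injective (lift K (FreeAlgebra.ι K : X → FreeAlgebra K X)) := by
  let b := Module.Basis.ofVectorSpace K (FreeLieAlgebra K X)
  classical
  let _ := linearOrderOfSTO
    (WellOrderingRel (α := Module.Basis.ofVectorSpaceIndex K (FreeLieAlgebra K X)))
  let F := FreeAlgebra.lift K fun x : X ↦ b.toStraightenQuotient (of K x)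
  have hF : (F : FreeAlgebra K X →ₗ⁅K⁆ _).comp (lift K (FreeAlgebra.ι K)) =
      b.toStraightenQuotient := by
    ext x
    simp [F]
  refine Function.Injective.of_comp (f := F) ?_
  have := b.toStraightenQuotient_injective
  rw [← hF] at this
  exact this

theorem lift_zero_lift_freeAlgebra_ι (w : FreeLieAlgebra K X) :
    FreeAlgebra.lift K (0 : X → K) (lift K (FreeAlgebra.ι K) w) = 0 := by
  have : (FreeAlgebra.lift K (0 : X → K) : FreeAlgebra K X →ₗ⁅K⁆ K).comp
      (lift K (FreeAlgebra.ι K)) = 0 := by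
    ext x
    simp
  exact congr($this w)

end FreeLieAlgebra

namespace FreeAlgebra

variable {R X : Type*} [CommRing R]

open Classical in
/-- The Fox derivative with respect to the letter `a`, presented by upper triangular matrices
`!![p, ∂p; 0, ε p]`. -/
noncomputable def foxMatrix (a : X) :
    FreeAlgebra R X →ₐ[R] Matrix (Fin 2) (Fin 2) (FreeAlgebra R X) :=
  lift R fun x ↦ !![ι R x, if x = a then 1 else 0; 0, 0]

theorem exists_foxMatrix_eq (a : X) (p : FreeAlgebra R X) :
    ∃ q, foxMatrix a p = !![p, q; 0, algebraMap R _ (lift R (0 : X → R) p)] := by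
  induction p using FreeAlgebra.induction with
  | grade0 r =>
    exact ⟨0, by
      ext i j; fin_cases i <;> fin_cases j <;> simp [Matrix.algebraMap_matrix_apply]⟩
  | grade1 x => classical exact ⟨if x = a then 1 else 0, by simp [foxMatrix]⟩
  | mul p q hp hq =>
    obtain ⟨p', hp⟩ := hp
    obtain ⟨q', hq⟩ := hq
    exact ⟨p * q' + p' * algebraMap R _ (lift R (0 : X → R) q),
      by simp [hp, hq, ← Algebra.smul_def]⟩
  | add p q hp hq =>
    obtain ⟨p', hp⟩ := hp
    obtain ⟨q', hq⟩ := hq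
    exact ⟨p' + q', by simp [hp, hq]⟩

/-- Only scalars commute with two distinct letters of a free associative algebra. -/
theorem eq_algebraMap_of_commute [IsDomain R] {a₁ a₂ : X} (ha : a₁ ≠ a₂) {p : FreeAlgebra R X}
    (h₁ : Commute p (ι R a₁)) (h₂ : Commute p (ι R a₂)) :
    p = algebraMap R _ (lift R (0 : X → R) p) := by
  obtain ⟨q, hq⟩ := exists_foxMatrix_eq a₁ p
  have e₁ := congr($((h₁.map (foxMatrix a₁)).eq) 0 1)
  have e₂ := congr($((h₂.map (foxMatrix a₁)).eq) 0 1)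
  rw [hq] at e₁ e₂
  simp [foxMatrix, ha.symm, ι_ne_zero] at e₁ e₂
  simpa [e₂] using e₁

end FreeAlgebra

/-- Distinct generators of a free Lie algebra have trivial common annihilator. -/
theorem FreeLieAlgebra.eq_zero_of_lie_of_eq_zero {K X : Type*} [Field K] {a₁ a₂ : X}
    (ha : a₁ ≠ a₂) {w : FreeLieAlgebra K X} (h₁ : ⁅w, of K a₁⁆ = 0) (h₂ : ⁅w, of K a₂⁆ = 0) :
    w = 0 := by
  let _ := LieRing.ofAssociativeRing (A := FreeAlgebra K X)
  apply lift_freeAlgebra_ι_injective K X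
  have e₁ := congrArg (lift K (FreeAlgebra.ι K)) h₁
  have e₂ := congrArg (lift K (FreeAlgebra.ι K)) h₂
  rw [LieHom.map_lie, lift_of_apply, map_zero, ← commute_iff_lie_eq] at e₁ e₂
  rw [FreeAlgebra.eq_algebraMap_of_commute ha e₁ e₂, lift_zero_lift_freeAlgebra_ι]
  simp

theorem free_lie_scalar_action_defined {K : Type*} [Field K] {X : Type*} (a₁ a₂ : X)
    (ha : a₁ ≠ a₂) (x z : FreeLieAlgebra K X) (α : K)
    (h1 : ⁅z, FreeLieAlgebra.of K a₁⁆ = ⁅x, α • FreeLieAlgebra.of K a₁⁆)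
    (h2 : ⁅z, FreeLieAlgebra.of K a₂⁆ = ⁅x, α • FreeLieAlgebra.of K a₂⁆) :
    z = α • x := by
  rw [← sub_eq_zero]
  apply FreeLieAlgebra.eq_zero_of_lie_of_eq_zero ha
  · rw [sub_lie, h1, lie_smul, smul_lie, sub_self]
  · rw [sub_lie, h2, lie_smul, smul_lie, sub_self]
end
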